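/- Let E be the sequence ⟨1, 2, 2^{-1}, 2^2, 2^{-2}, 2^3, 2^{-3}, …⟩ (i.e., E(0)=1, E(2m-1)=2^m and E(2m)=2^{-m} for m ≥ 1), and let E_1 be its cofinite subsequence E_1(n) = E(n+2). Then X(E_1) ∩ (1,2) = ∅; in particular, E_1 is not dense-expandable, even though E itself is dense-expandable. Hence a cofinite subsequence of a dense-expandable sequence need not be dense-expandable. -/

import Mathlib

/-- The sequence `⟨1, 2, 2⁻¹, 2², 2⁻², 2³, 2⁻³, …⟩`:
`E 0 = 1`, `E (2m-1) = 2^m` and `E (2m) = 2^(-m)` for `m ≥ 1`. -/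
noncomputable def Eseq : ℕ → ℝ := fun n =>
  if n = 0 then 1
  else if n % 2 = 1 then (2 : ℝ) ^ ((n + 1) / 2)
  else (2 : ℝ) ^ (-((n / 2 : ℕ) : ℤ))

/-- The set `X(E)` of finite signed sums of a sequence `E`. -/
def signedSums (E : ℕ → ℝ) : Set ℝ :=
  {x : ℝ | ∃ S : Finset ℕ, ∃ ε : ℕ → ℝ,
    (∀ n ∈ S, ε n = -1 ∨ ε n = 1) ∧ x = ∑ n ∈ S, ε n * E n}

/-- Each signed term of the shifted sequence lies within a geometric error of `4ℤ`. -/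
theorem exists_int_abs_sub_four_mul_le (n : ℕ) (e : ℝ) (he : e = -1 ∨ e = 1) :
    ∃ a : ℤ, |e * Eseq (n + 2) - 4 * a| ≤ if n % 2 = 0 then (1 / 2 : ℝ) ^ (n / 2 + 1) else 0 := by
  rcases Nat.even_or_odd' n with ⟨m, rfl | rfl⟩
  · refine ⟨0, ?_⟩
    have h1 : (2 * m + 2) % 2 ≠ 1 := by lia
    have h2 : (2 * m + 2) / 2 = m + 1 := by lia
    have h3 : 2 * m % 2 = 0 := by lia
    have h4 : 2 * m / 2 = m := by lia
    have hE : Eseq (2 * m + 2) = (1 / 2 : ℝ) ^ (m + 1) := by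
      simp only [Eseq, h1, h2, if_false]
      rw [zpow_neg, zpow_natCast]
      simp
    have habs : |e| = 1 := by rcases he with rfl | rfl <;> simp
    rw [hE, if_pos h3, h4, Int.cast_zero, mul_zero, sub_zero, abs_mul, habs, one_mul,
      abs_of_nonneg (by positivity)]
  · have h1 : (2 * m + 1 + 2) % 2 = 1 := by lia
    have h2 : (2 * m + 1 + 2 + 1) / 2 = m + 2 := by lia
    have h3 : (2 * m + 1) % 2 ≠ 0 := by lia
    have hE : Eseq (2 * m + 1 + 2) = (2 : ℝ) ^ (m + 2) := by
      simp only [Eseq, h1, h2, if_true]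
      simp
    rw [hE, if_neg h3]
    rcases he with rfl | rfl
    · exact ⟨-2 ^ m, by push_cast; rw [pow_add]; ring_nf; simp⟩
    · exact ⟨2 ^ m, by push_cast; rw [pow_add]; ring_nf; simp⟩

theorem sum_range_two_mul_geometric (N : ℕ) :
    ∑ n ∈ Finset.range (2 * N), (if n % 2 = 0 then (1 / 2 : ℝ) ^ (n / 2 + 1) else 0) =
      1 - (1 / 2) ^ N := by
  induction N with
  | zero => simp
  | succ N ih =>
    have h1 : (2 * N + 1) % 2 ≠ 0 := by lia
    have h2 : 2 * N % 2 = 0 := by lia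
    have h3 : 2 * N / 2 = N := by lia
    rw [show 2 * (N + 1) = 2 * N + 1 + 1 by ring, Finset.sum_range_succ, Finset.sum_range_succ, ih,
      if_neg h1, if_pos h2, h3]
    ring

/-- Signed sums of the shifted sequence lie at distance less than `1` from `4ℤ`. -/
theorem exists_int_abs_sub_four_mul_lt_one {x : ℝ}
    (hx : x ∈ signedSums (fun n => Eseq (n + 2))) : ∃ a : ℤ, |x - 4 * a| < 1 := by
  obtain ⟨S, e, he, rfl⟩ := hx
  choose! a ha using fun n (hn : n ∈ S) => exists_int_abs_sub_four_mul_le n (e n) (he n hn)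
  refine ⟨∑ n ∈ S, a n, ?_⟩
  have hS : S ⊆ Finset.range (2 * (S.sup id + 1)) := fun n hn => by
    have : n ≤ S.sup id := Finset.le_sup (f := id) hn
    rw [Finset.mem_range]
    lia
  calc |∑ n ∈ S, e n * Eseq (n + 2) - 4 * ((∑ n ∈ S, a n : ℤ) : ℝ)|
      = |∑ n ∈ S, (e n * Eseq (n + 2) - 4 * a n)| := by
        rw [Finset.sum_sub_distrib, ← Finset.mul_sum]
        push_cast
        rfl
    _ ≤ ∑ n ∈ S, |e n * Eseq (n + 2) - 4 * a n| := Finset.abs_sum_le_sum_abs _ _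
    _ ≤ ∑ n ∈ S, (if n % 2 = 0 then (1 / 2 : ℝ) ^ (n / 2 + 1) else 0) := Finset.sum_le_sum ha
    _ ≤ ∑ n ∈ Finset.range (2 * (S.sup id + 1)),
          (if n % 2 = 0 then (1 / 2 : ℝ) ^ (n / 2 + 1) else 0) :=
        Finset.sum_le_sum_of_subset_of_nonneg hS fun n _ _ => by split_ifs <;> positivity
    _ < 1 := by
        rw [sum_range_two_mul_geometric]
        have : (0 : ℝ) < (1 / 2) ^ (S.sup id + 1) := by positivity
        linarith

/-- Every integer power of `2` is a term of the sequence. -/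
theorem exists_Eseq_eq_zpow (j : ℤ) : ∃ n : ℕ, Eseq n = (2 : ℝ) ^ j := by
  obtain ⟨m, rfl | rfl⟩ := j.eq_nat_or_neg
  · rcases m with _ | m
    · exact ⟨0, by simp [Eseq]⟩
    · have h1 : (2 * m + 1) % 2 = 1 := by lia
      have h2 : (2 * m + 1 + 1) / 2 = m + 1 := by lia
      refine ⟨2 * m + 1, ?_⟩
      rw [zpow_natCast]
      simp only [Eseq, h1, h2, if_true]
      simp
  · rcases m with _ | m
    · exact ⟨0, by simp [Eseq]⟩
    · have h1 : (2 * (m + 1)) % 2 ≠ 1 := by lia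
      have h2 : 2 * (m + 1) / 2 = m + 1 := by lia
      refine ⟨2 * (m + 1), ?_⟩
      simp only [Eseq, h1, h2, if_false]
      simp

theorem neg_mem_signedSums {E : ℕ → ℝ} {x : ℝ} (hx : x ∈ signedSums E) : -x ∈ signedSums E := by
  obtain ⟨S, e, he, rfl⟩ := hx
  refine ⟨S, fun n => -e n, fun n hn => ?_, by simp⟩
  rcases he n hn with h | h <;> simp [h]

theorem natCast_div_two_pow_mem_signedSums_Eseq (k N : ℕ) :
    (k : ℝ) / 2 ^ N ∈ signedSums Eseq := by
  choose φ hφ using exists_Eseq_eq_zpow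
  have hinj : Function.Injective fun i : ℕ => φ (i - N) := fun i j hij => by
    have h : (2 : ℝ) ^ ((i : ℤ) - N) = 2 ^ ((j : ℤ) - N) := by
      rw [← hφ, ← hφ]
      exact congrArg Eseq hij
    have := zpow_right_injective₀ (by norm_num : (0 : ℝ) < 2) (by norm_num) h
    lia
  refine ⟨k.bitIndices.toFinset.map ⟨_, hinj⟩, fun _ => 1, fun _ _ => Or.inr rfl, ?_⟩
  have hk : (k : ℝ) = ∑ i ∈ k.bitIndices.toFinset, (2 : ℝ) ^ i := by
    exact_mod_cast (Finset.sum_toFinset_bitIndices_two_pow k).symm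
  rw [Finset.sum_map, hk, Finset.sum_div]
  refine Finset.sum_congr rfl fun i _ => ?_
  rw [one_mul, Function.Embedding.coeFn_mk, hφ, zpow_sub₀ two_ne_zero, zpow_natCast, zpow_natCast]

theorem intCast_div_two_pow_mem_signedSums_Eseq (z : ℤ) (N : ℕ) :
    (z : ℝ) / 2 ^ N ∈ signedSums Eseq := by
  obtain ⟨k, rfl | rfl⟩ := z.eq_nat_or_neg
  · rw [Int.cast_natCast]
    exact natCast_div_two_pow_mem_signedSums_Eseq k N
  · have := neg_mem_signedSums (natCast_div_two_pow_mem_signedSums_Eseq k N)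
    rwa [← neg_div, ← Int.cast_natCast, ← Int.cast_neg] at this

theorem dense_signedSums_Eseq : Dense (signedSums Eseq) := by
  refine dense_of_exists_between fun x y hxy => ?_
  obtain ⟨N, hN⟩ := exists_pow_lt_of_lt_one (sub_pos.2 hxy) (by norm_num : (1 / 2 : ℝ) < 1)
  have hpos : (0 : ℝ) < 2 ^ N := by positivity
  rw [one_div_pow, div_lt_iff₀ hpos] at hN
  refine ⟨_, intCast_div_two_pow_mem_signedSums_Eseq (⌊x * 2 ^ N⌋ + 1) N, ?_, ?_⟩
  · rw [lt_div_iff₀ hpos]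
    push_cast
    exact Int.lt_floor_add_one _
  · rw [div_lt_iff₀ hpos]
    have := Int.floor_le (x * 2 ^ N)
    push_cast
    linarith

/-- with `E = ⟨1, 2, 2⁻¹, 2², 2⁻², …⟩` and its cofinite
subsequence `E₁(n) = E(n+2)`, one has `X(E₁) ∩ (1,2) = ∅`, so `E₁` is not
dense-expandable, although `E` itself is dense-expandable. -/
theorem cofinite_subsequence_not_dense_expandable :
    signedSums (fun n => Eseq (n + 2)) ∩ Set.Ioo (1 : ℝ) 2 = ∅ ∧
    ¬ Dense (signedSums (fun n => Eseq (n + 2))) ∧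
    Dense (signedSums Eseq) := by
  have hdisj : signedSums (fun n => Eseq (n + 2)) ∩ Set.Ioo (1 : ℝ) 2 = ∅ := by
    refine Set.eq_empty_of_forall_notMem ?_
    rintro x ⟨hx, h1, h2⟩
    obtain ⟨a, ha⟩ := exists_int_abs_sub_four_mul_lt_one hx
    obtain ⟨hl, hr⟩ := abs_lt.1 ha
    have hpos : (0 : ℝ) < a := by linarith
    have hlt : (a : ℝ) < 1 := by linarith
    norm_cast at hpos hlt
    lia
  refine ⟨hdisj, fun hd => ?_, dense_signedSums_Eseq⟩
  obtain ⟨x, hx, hxI⟩ := hd.exists_between (by norm_num : (1 : ℝ) < 2)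
  exact Set.eq_empty_iff_forall_notMem.1 hdisj x ⟨hx, hxI⟩
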